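/- Let U ⊆ ℝ^m be open and simply connected, and let A₁, …, A_m : U → ℝ^{s×s} be smooth matrix-valued functions satisfying the integrability condition ∂_j A_i + A_i A_j = ∂_i A_j + A_j A_i on U for all 1 ≤ i < j ≤ m. Then for every z̄ ∈ U and every q̄ ∈ ℝ^s there exists a unique continuously differentiable solution q : U → ℝ^s of the Pfaffian system ∂_i q = A_i q (i = 1, …, m) with boundary condition q(z̄) = q̄. -/

import Mathlib

open Matrix

/-- Entrywise partial derivative `∂_i` of a matrix-valued function on `ℝ^m`. -/
noncomputable def pdM {m s : ℕ} (i : Fin m) (M : (Fin m → ℝ) → Matrix (Fin s) (Fin s) ℝ) :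
    (Fin m → ℝ) → Matrix (Fin s) (Fin s) ℝ :=
  fun z => Matrix.of fun k l => fderiv ℝ (fun y => M y k l) z (Pi.single i 1)

section Frobenius

open Set Filter Topology Metric

section ParallelTransport

set_option maxSynthPendingDepth 3

variable {E F : Type*} [NormedAddCommGroup E] [NormedSpace ℝ E]
  [NormedAddCommGroup F] [NormedSpace ℝ F]

/-- `q` solves the total differential equation `dq = Ω q` at every point of `s`. -/
def IsParallelOn (Ω : E → E →L[ℝ] F →L[ℝ] F) (q : E → F) (s : Set E) : Prop :=
  ∀ z ∈ s, HasFDerivAt q ((Ω z).flip (q z)) z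

/-- The curvature form of `Ω` vanishes at `z`. -/
def IsFlatAt (Ω : E → E →L[ℝ] F →L[ℝ] F) (z : E) : Prop :=
  ∀ h k : E, fderiv ℝ Ω z h k + (Ω z k).comp (Ω z h) = fderiv ℝ Ω z k h + (Ω z h).comp (Ω z k)

lemma IsParallelOn.mono {Ω : E → E →L[ℝ] F →L[ℝ] F} {q : E → F} {s t : Set E}
    (hq : IsParallelOn Ω q t) (hst : s ⊆ t) : IsParallelOn Ω q s :=
  fun z hz => hq z (hst hz)

lemma HasDerivWithinAt.Ici_of_Icc {u : ℝ → F} {u' : F} {t : ℝ} (ht : t ∈ Ico (0 : ℝ) 1)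
    (hu : HasDerivWithinAt u u' (Icc 0 1) t) : HasDerivWithinAt u u' (Ici t) t :=
  hu.mono_of_mem_nhdsWithin (Icc_mem_nhdsGE_of_mem ht)

lemma lipschitzOnWith_clm {L : F →L[ℝ] F} {K : NNReal} (hK : ‖L‖ ≤ K) (s : Set F) :
    LipschitzOnWith K L s :=
  (L.lipschitz.weaken (by exact_mod_cast hK)).lipschitzOnWith

lemma hasDerivAt_add_smul (x w : E) (t : ℝ) : HasDerivAt (fun t : ℝ => x + t • w) w t := by
  simpa using ((hasDerivAt_id t).smul_const w).const_add x

lemma IsParallelOn.hasDerivAt_line {Ω : E → E →L[ℝ] F →L[ℝ] F} {q : E → F} {s : Set E}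
    (hq : IsParallelOn Ω q s) (x w : E) {t : ℝ} (ht : x + t • w ∈ s) :
    HasDerivAt (fun t : ℝ => q (x + t • w)) (Ω (x + t • w) w (q (x + t • w))) t := by
  simpa [Function.comp_def] using (hq _ ht).comp_hasDerivAt t (hasDerivAt_add_smul x w t)

lemma continuousOn_line {Ω : E → E →L[ℝ] F →L[ℝ] F} {s : Set E} (hs : Convex ℝ s)
    (hΩ : ContinuousOn Ω s) {x y : E} (hx : x ∈ s) (hy : y ∈ s) :
    ContinuousOn (fun t : ℝ => Ω (x + t • (y - x)) (y - x)) (Icc 0 1) := by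
  have h : ContinuousOn (fun t : ℝ => Ω (x + t • (y - x))) (Icc 0 1) :=
    hΩ.comp (by fun_prop) fun t ht => hs.add_smul_sub_mem hx hy ht
  exact h.clm_apply continuousOn_const

/-- On a convex set, solutions are determined by their value at one point. -/
lemma IsParallelOn.eqOn_of_convex {Ω : E → E →L[ℝ] F →L[ℝ] F} {s : Set E} (hs : Convex ℝ s)
    (hΩ : ContinuousOn Ω s) {q₁ q₂ : E → F} (h₁ : IsParallelOn Ω q₁ s)
    (h₂ : IsParallelOn Ω q₂ s) {x : E} (hx : x ∈ s) (hxe : q₁ x = q₂ x) : EqOn q₁ q₂ s := by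
  intro y hy
  obtain ⟨K, hK⟩ := isCompact_Icc.exists_bound_of_continuousOn (continuousOn_line hs hΩ hx hy)
  have hmem : ∀ t ∈ Icc (0 : ℝ) 1, x + t • (y - x) ∈ s := fun t ht =>
    hs.add_smul_sub_mem hx hy ht
  have key := ODE_solution_unique_of_mem_Icc_right (a := 0) (b := 1) (K := K.toNNReal)
    (v := fun t p => Ω (x + t • (y - x)) (y - x) p) (s := fun _ => univ)
    (f := fun t : ℝ => q₁ (x + t • (y - x))) (g := fun t : ℝ => q₂ (x + t • (y - x)))
    (fun t ht => lipschitzOnWith_clm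
      ((hK t (Ico_subset_Icc_self ht)).trans (Real.le_coe_toNNReal K)) _)
    (fun t ht => (h₁.hasDerivAt_line x _ (hmem t ht)).continuousAt.continuousWithinAt)
    (fun t ht => (h₁.hasDerivAt_line x _ (hmem t (Ico_subset_Icc_self ht))).hasDerivWithinAt)
    (fun _ _ => mem_univ _)
    (fun t ht => (h₂.hasDerivAt_line x _ (hmem t ht)).continuousAt.continuousWithinAt)
    (fun t ht => (h₂.hasDerivAt_line x _ (hmem t (Ico_subset_Icc_self ht))).hasDerivWithinAt)
    (fun _ _ => mem_univ _) (by simpa using hxe)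
  simpa using key (right_mem_Icc.2 zero_le_one)

/-- Existence of parallel transport along short segments. -/
lemma exists_transport_along_segment [CompleteSpace F] {Ω : E → E →L[ℝ] F →L[ℝ] F} {s : Set E}
    (hs : Convex ℝ s) (hΩ : ContinuousOn Ω s) {M : ℝ} (hM : ∀ z ∈ s, ‖Ω z‖ ≤ M) {x y : E}
    (hx : x ∈ s) (hy : y ∈ s) (hxy : M * ‖y - x‖ ≤ 1 / 2) (v : F) :
    ∃ u : ℝ → F, u 0 = v ∧ ∀ t ∈ Icc (0 : ℝ) 1,
      HasDerivWithinAt u (Ω (x + t • (y - x)) (y - x) (u t)) (Icc 0 1) t := by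
  have hB : ∀ t ∈ Icc (0 : ℝ) 1, ‖Ω (x + t • (y - x)) (y - x)‖ ≤ 1 / 2 := fun t ht =>
    ((Ω _).le_of_opNorm_le (hM _ (hs.add_smul_sub_mem hx hy ht)) _).trans hxy
  have hPL : IsPicardLindelof (fun (t : ℝ) p => Ω (x + t • (y - x)) (y - x) p)
      (⟨0, left_mem_Icc.2 zero_le_one⟩ : Icc (0 : ℝ) 1) v ‖v‖₊ 0 ‖v‖₊ 1 := by
    refine ⟨fun t ht => lipschitzOnWith_clm ((hB t ht).trans (by norm_num)) _,
      fun p _ => (continuousOn_line hs hΩ hx hy).clm_apply continuousOn_const,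
      fun t ht p hp => ?_, by simp⟩
    have hp' : ‖p‖ ≤ ‖v‖ + ‖v‖ := by
      have := norm_le_norm_add_norm_sub' p v
      rw [mem_closedBall, dist_eq_norm, coe_nnnorm] at hp
      linarith
    calc _ ≤ 1 / 2 * ‖p‖ := ContinuousLinearMap.le_of_opNorm_le _ (hB t ht) p
      _ ≤ 1 / 2 * (‖v‖ + ‖v‖) := by gcongr
      _ = ‖v‖₊ := by rw [coe_nnnorm]; ring
  exact hPL.exists_eq_forall_mem_Icc_hasDerivWithinAt₀

/-- The first variation of a transported vector solves the varied transport equation up to a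
quadratic error, when the curvature vanishes. -/
lemma norm_variation_sub_le {O O' : E →L[ℝ] F →L[ℝ] F} {D : E →L[ℝ] E →L[ℝ] F →L[ℝ] F}
    {w h : E} {u : F} {t M C : ℝ} (ht : t ∈ Icc (0 : ℝ) 1) (hO : ‖O‖ ≤ M) (hD : ‖D‖ ≤ M)
    (hR : ‖O' - O - D (t • h)‖ ≤ M * ‖h‖ ^ 2) (hw : ‖w + h‖ ≤ 1) (hh : ‖h‖ ≤ 1) (hu : ‖u‖ ≤ C)
    (hflat : D w h u + O h (O w u) = D h w u + O w (O h u)) :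
    ‖(O w u + (O h u + t • (D w h u + O h (O w u)))) - O' (w + h) (u + t • O h u)‖ ≤
      M * C * (2 + 3 * M) * ‖h‖ ^ 2 := by
  obtain ⟨R, hRdef⟩ : ∃ R, R = O' - O - D (t • h) := ⟨_, rfl⟩
  have hO' : O' = O + t • D h + R := by rw [hRdef, map_smul]; abel
  rw [← hRdef] at hR
  have hM : 0 ≤ M := (norm_nonneg _).trans hO
  have hC : 0 ≤ C := (norm_nonneg _).trans hu
  have hOh : ∀ p, ‖O h p‖ ≤ M * ‖h‖ * ‖p‖ := fun p =>
    (O h).le_of_opNorm_le (O.le_of_opNorm_le hO h) p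
  have hDh : ∀ k p, ‖D h k p‖ ≤ M * ‖h‖ * ‖k‖ * ‖p‖ := fun k p =>
    (D h k).le_of_opNorm_le ((D h).le_of_opNorm_le (D.le_of_opNorm_le hD h) k) p
  have hRw : ∀ p, ‖R (w + h) p‖ ≤ M * ‖h‖ ^ 2 * ‖w + h‖ * ‖p‖ := fun p =>
    (R (w + h)).le_of_opNorm_le (R.le_of_opNorm_le hR _) p
  have hsmul : ∀ p : F, ‖t • p‖ ≤ ‖p‖ := fun p => by
    rw [norm_smul, Real.norm_of_nonneg ht.1]
    exact mul_le_of_le_one_left (norm_nonneg _) ht.2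
  have hOu : ‖O h u‖ ≤ M * ‖h‖ * C := (hOh u).trans (by gcongr)
  have hOu' : ‖O h u‖ ≤ M * C := hOu.trans (by nlinarith [mul_nonneg hM hC])
  have e : (O w u + (O h u + t • (D w h u + O h (O w u)))) - O' (w + h) (u + t • O h u) =
      -(R (w + h) (u + t • O h u) + t • O h (O h u) + t • D h h u
        + t • t • D h (w + h) (O h u)) := by
    rw [hflat, hO']
    simp only [map_add, map_smul, _root_.add_apply, _root_.smul_apply]
    module
  have b1 : ‖R (w + h) (u + t • O h u)‖ ≤ M * ‖h‖ ^ 2 * 1 * (C + M * C) := by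
    refine (hRw _).trans ?_
    gcongr
    exact (norm_add_le _ _).trans (add_le_add hu ((hsmul _).trans hOu'))
  have b2 : ‖t • O h (O h u)‖ ≤ M * ‖h‖ * (M * ‖h‖ * C) :=
    (hsmul _).trans ((hOh _).trans (by gcongr))
  have b3 : ‖t • D h h u‖ ≤ M * ‖h‖ * ‖h‖ * C :=
    (hsmul _).trans ((hDh _ _).trans (by gcongr))
  have b4 : ‖t • t • D h (w + h) (O h u)‖ ≤ M * ‖h‖ * 1 * (M * ‖h‖ * C) :=
    (hsmul _).trans ((hsmul _).trans ((hDh _ _).trans (by gcongr)))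
  rw [e, norm_neg]
  refine (norm_add₄_le).trans ?_
  nlinarith

/-- **Local Frobenius theorem** on a small convex open set. -/
lemma exists_isParallelOn_of_convex [CompleteSpace F] {Ω : E → E →L[ℝ] F →L[ℝ] F} {s : Set E}
    (hs : Convex ℝ s) (hso : IsOpen s) (hd : ∀ z ∈ s, DifferentiableAt ℝ Ω z)
    (hflat : ∀ z ∈ s, IsFlatAt Ω z) {M : ℝ} (hM : ∀ z ∈ s, ‖Ω z‖ ≤ M)
    (hM' : ∀ z ∈ s, ‖fderiv ℝ Ω z‖ ≤ M)
    (hT : ∀ x ∈ s, ∀ y ∈ s, ‖Ω y - Ω x - fderiv ℝ Ω x (y - x)‖ ≤ M * ‖y - x‖ ^ 2)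
    (hdiam : ∀ x ∈ s, ∀ y ∈ s, ‖y - x‖ ≤ 1) (hMdiam : ∀ x ∈ s, ∀ y ∈ s, M * ‖y - x‖ ≤ 1 / 2)
    {x : E} (hx : x ∈ s) (v : F) : ∃ q : E → F, IsParallelOn Ω q s ∧ q x = v := by
  have hΩ : ContinuousOn Ω s := fun z hz => (hd z hz).continuousAt.continuousWithinAt
  have hex : ∀ y : E, ∃ u : ℝ → F, y ∈ s → u 0 = v ∧ ∀ t ∈ Icc (0 : ℝ) 1,
      HasDerivWithinAt u (Ω (x + t • (y - x)) (y - x) (u t)) (Icc 0 1) t := fun y => by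
    by_cases hy : y ∈ s
    · obtain ⟨u, hu⟩ := exists_transport_along_segment hs hΩ hM hx hy (hMdiam x hx y hy) v
      exact ⟨u, fun _ => hu⟩
    · exact ⟨0, fun h => absurd h hy⟩
  choose u hu using hex
  refine ⟨fun y => u y 1, fun z hz => ?_, ?_⟩
  · obtain ⟨hu0, huz⟩ := hu z hz
    have hcont : ContinuousOn (u z) (Icc 0 1) := fun t ht => (huz t ht).continuousWithinAt
    obtain ⟨C, hC⟩ := isCompact_Icc.exists_bound_of_continuousOn hcont
    have hmem : ∀ t ∈ Icc (0 : ℝ) 1, x + t • (z - x) ∈ s := fun t ht =>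
      hs.add_smul_sub_mem hx hz ht
    have key : ∀ y ∈ s, ‖u y 1 - u z 1 - Ω z (y - z) (u z 1)‖ ≤
        M * C * (2 + 3 * M) * (Real.exp 1 - 1) * ‖y - z‖ ^ 2 := by
      intro y hy
      obtain ⟨hy0, huy⟩ := hu y hy
      have hyx : y - x = (z - x) + (y - z) := by abel
      have hymem : ∀ t ∈ Icc (0 : ℝ) 1, x + t • (y - x) ∈ s := fun t ht =>
        hs.add_smul_sub_mem hx hy ht
      have hvar : ∀ t ∈ Icc (0 : ℝ) 1, HasDerivWithinAt
          (fun t => u z t + t • Ω (x + t • (z - x)) (y - z) (u z t))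
          (Ω (x + t • (z - x)) (z - x) (u z t) + (Ω (x + t • (z - x)) (y - z) (u z t) +
            t • (fderiv ℝ Ω (x + t • (z - x)) (z - x) (y - z) (u z t) +
              Ω (x + t • (z - x)) (y - z) (Ω (x + t • (z - x)) (z - x) (u z t)))))
          (Icc 0 1) t := by
        intro t ht
        have h1 : HasDerivWithinAt (fun t : ℝ => Ω (x + t • (z - x)))
            (fderiv ℝ Ω (x + t • (z - x)) (z - x)) (Icc 0 1) t :=
          HasFDerivAt.comp_hasDerivWithinAt (l := Ω) t (hd _ (hmem t ht)).hasFDerivAt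
            (hasDerivAt_add_smul x (z - x) t).hasDerivWithinAt
        have h2 := (h1.clm_apply (hasDerivWithinAt_const t (Icc 0 1) (y - z))).clm_apply (huz t ht)
        refine ((huz t ht).add ((hasDerivWithinAt_id t _).smul h2)).congr_deriv ?_
        simp [add_comm]
      have hlip : ∀ t ∈ Ico (0 : ℝ) 1,
          LipschitzOnWith 1 (fun p => Ω (x + t • (y - x)) (y - x) p) univ := fun t ht =>
        lipschitzOnWith_clm (((Ω _).le_of_opNorm_le
          (hM _ (hymem t (Ico_subset_Icc_self ht))) _).trans
            ((hMdiam x hx y hy).trans (by norm_num))) _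
      have hgr := dist_le_of_approx_trajectories_ODE_of_mem (a := 0) (b := 1) (δ := 0)
        (εg := 0) (εf := M * C * (2 + 3 * M) * ‖y - z‖ ^ 2) hlip
        (fun t ht => (hvar t ht).continuousWithinAt)
        (fun t ht => (hvar t (Ico_subset_Icc_self ht)).Ici_of_Icc ht)
        (fun t ht => ?_) (fun _ _ => mem_univ _)
        (fun t ht => (huy t ht).continuousWithinAt)
        (fun t ht => (huy t (Ico_subset_Icc_self ht)).Ici_of_Icc ht)
        (fun t ht => (dist_self _).le) (fun _ _ => mem_univ _) (by simp [hu0, hy0])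
        1 (right_mem_Icc.2 zero_le_one)
      · rw [dist_comm, dist_eq_norm, gronwallBound_of_K_ne_0 (by simp)] at hgr
        simp only [one_smul, add_sub_cancel, NNReal.coe_one, sub_zero, add_zero, zero_mul,
          zero_add, div_one, mul_one] at hgr
        rw [sub_sub]
        refine hgr.trans_eq (by ring)
      · have ht' := Ico_subset_Icc_self ht
        rw [dist_eq_norm]
        have hpt : x + t • (y - x) - (x + t • (z - x)) = t • (y - z) := by module
        have hR := hT _ (hmem t ht') _ (hymem t ht')
        rw [hpt] at hR
        have hM0 : 0 ≤ M := (norm_nonneg _).trans (hM x hx)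
        have := norm_variation_sub_le (w := z - x) (h := y - z) (u := u z t) ht'
          (hM _ (hmem t ht')) (hM' _ (hmem t ht')) (hR.trans ?_)
          (by rw [← hyx]; exact hdiam x hx y hy) (hdiam z hz y hy) (hC t ht')
          (congrArg (fun L : F →L[ℝ] F => L (u z t)) (hflat _ (hmem t ht') (z - x) (y - z)))
        · rwa [← hyx] at this
        · have hth : ‖t • (y - z)‖ ≤ ‖y - z‖ := by
            rw [norm_smul, Real.norm_of_nonneg ht.1]
            exact mul_le_of_le_one_left (norm_nonneg _) ht.2.le
          gcongr
    rw [hasFDerivAt_iff_isLittleO]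
    refine Asymptotics.IsBigO.trans_isLittleO (g := fun y => ‖y - z‖ ^ 2)
      (Asymptotics.IsBigO.of_bound (M * C * (2 + 3 * M) * (Real.exp 1 - 1)) ?_) ?_
    · filter_upwards [hso.mem_nhds hz] with y hy
      simpa using key y hy
    · exact Asymptotics.isLittleO_pow_sub_sub z one_lt_two
  · obtain ⟨h0, h1⟩ := hu x hx
    have hc := constant_of_derivWithin_zero (f := u x) (a := 0) (b := 1)
      (fun t ht => (h1 t ht).differentiableWithinAt) (fun t ht => by
        simpa using (h1 t (Ico_subset_Icc_self ht)).derivWithin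
          (uniqueDiffOn_Icc zero_lt_one t (Ico_subset_Icc_self ht)))
    exact (hc 1 (right_mem_Icc.2 zero_le_one)).trans h0

/-- **Local Frobenius theorem**: around every point there is a convex open set on which the
equation `dq = Ω q` is solvable with arbitrary initial value at an arbitrary point. -/
lemma exists_convex_forall_isParallelOn [CompleteSpace F] {Ω : E → E →L[ℝ] F →L[ℝ] F}
    {U : Set E} (hU : IsOpen U) (hΩ : ContDiffOn ℝ 2 Ω U) (hflat : ∀ z ∈ U, IsFlatAt Ω z)
    {c : E} (hc : c ∈ U) :
    ∃ s ⊆ U, IsOpen s ∧ Convex ℝ s ∧ c ∈ s ∧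
      ∀ x ∈ s, ∀ v : F, ∃ q : E → F, IsParallelOn Ω q s ∧ q x = v := by
  have hc2 : ContDiffAt ℝ 2 Ω c := hΩ.contDiffAt (hU.mem_nhds hc)
  have hc1 : ContDiffAt ℝ 1 (fderiv ℝ Ω) c := hc2.fderiv_right (by norm_num)
  obtain ⟨K, t, ht, hK⟩ := hc1.exists_lipschitzOnWith
  set M : ℝ := max (K : ℝ) (max (‖Ω c‖ + 1) (‖fderiv ℝ Ω c‖ + 1)) with hMdef
  have hM0 : 0 < M := by
    have : ‖Ω c‖ + 1 ≤ M := (le_max_left _ _).trans (le_max_right _ _)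
    linarith [norm_nonneg (Ω c)]
  have e1 : ∀ᶠ z in 𝓝 c, ‖Ω z‖ < ‖Ω c‖ + 1 :=
    hc2.continuousAt.norm.eventually_lt continuousAt_const (lt_add_one _)
  have e2 : ∀ᶠ z in 𝓝 c, ‖fderiv ℝ Ω z‖ < ‖fderiv ℝ Ω c‖ + 1 :=
    hc1.continuousAt.norm.eventually_lt continuousAt_const (lt_add_one _)
  obtain ⟨r, hr, hball⟩ := Metric.eventually_nhds_iff_ball.1
    (((hU.eventually_mem hc).and ht).and (e1.and e2))
  set ρ := min r (min (1 / 2) (1 / (4 * M))) with hρdef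
  have hρ : 0 < ρ := by positivity
  have hsub : ∀ z ∈ ball c ρ, z ∈ ball c r := fun z hz => ball_subset_ball (min_le_left _ _) hz
  have hdist : ∀ x ∈ ball c ρ, ∀ y ∈ ball c ρ, ‖y - x‖ ≤ 2 * ρ := fun x hx y hy => by
    rw [← dist_eq_norm]
    rw [mem_ball] at hx hy
    linarith [dist_triangle_right y x c]
  have hρ1 : ρ ≤ 1 / 2 := (min_le_right _ _).trans (min_le_left _ _)
  have hρ2 : ρ ≤ 1 / (4 * M) := (min_le_right _ _).trans (min_le_right _ _)
  have hd : ∀ z ∈ ball c ρ, DifferentiableAt ℝ Ω z := fun z hz =>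
    (hΩ.contDiffAt (hU.mem_nhds (hball z (hsub z hz)).1.1)).differentiableAt (by norm_num)
  refine ⟨ball c ρ, fun z hz => (hball z (hsub z hz)).1.1, isOpen_ball, convex_ball c ρ,
    mem_ball_self hρ, fun x hx v => exists_isParallelOn_of_convex (M := M) (convex_ball c ρ)
    isOpen_ball hd (fun z hz => hflat z (hball z (hsub z hz)).1.1)
    (fun z hz => (hball z (hsub z hz)).2.1.le.trans ((le_max_left _ _).trans (le_max_right _ _)))
    (fun z hz => (hball z (hsub z hz)).2.2.le.trans ((le_max_right _ _).trans (le_max_right _ _)))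
    ?_ (fun x hx y hy => (hdist x hx y hy).trans (by linarith))
    (fun x hx y hy => ?_) hx v⟩
  · intro x hx y hy
    have hseg : segment ℝ x y ⊆ ball c ρ := (convex_ball c ρ).segment_subset hx hy
    have := (convex_segment x y).norm_image_sub_le_of_norm_fderiv_le' (𝕜 := ℝ) (f := Ω)
      (φ := fderiv ℝ Ω x) (C := M * ‖y - x‖) (fun z hz => hd z (hseg hz)) (fun z hz => ?_)
      (left_mem_segment ℝ x y) (right_mem_segment ℝ x y)
    · exact this.trans_eq (by ring)
    · have h1 := hK.dist_le_mul z (hball z (hsub z (hseg hz))).1.2 x (hball x (hsub x hx)).1.2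
      rw [dist_eq_norm, dist_eq_norm] at h1
      exact h1.trans (mul_le_mul (le_max_left _ _) (norm_sub_le_of_mem_segment hz)
        (norm_nonneg _) hM0.le)
  · calc M * ‖y - x‖ ≤ M * (2 * (1 / (4 * M))) := by
          gcongr
          exact (hdist x hx y hy).trans (by linarith)
      _ = 1 / 2 := by field_simp; norm_num

end ParallelTransport

/-- On a simply connected, locally path connected space, a family of local fibrewise
bijections whose transition maps are locally constant admits global horizontal sections. -/
theorem exists_global_section_of_locally_constant_transition {X F : Type*} [TopologicalSpace X]
    [SimplyConnectedSpace X] [LocallyPathConnectedSpace X] (B : X → Set X)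
    (hBo : ∀ c, IsOpen (B c)) (hB : ∀ c, c ∈ B c) (Φ : X → X → Equiv.Perm F)
    (hΦ : ∀ c d, ∀ x ∈ B c ∩ B d, ∀ v, ∀ᶠ y in 𝓝 x,
      (Φ d y).symm (Φ c y v) = (Φ d x).symm (Φ c x v)) (x₀ : X) (v₀ : F) :
    ∃ q : X → F, q x₀ = v₀ ∧ ∀ c, ∃ v, ∀ᶠ x in 𝓝 c, q x = Φ c x v := by
  let _ : TopologicalSpace F := ⊥
  have : DiscreteTopology F := ⟨rfl⟩
  let Z : FiberBundleCore X X F :=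
    { baseSet := B
      isOpen_baseSet := hBo
      indexAt := id
      mem_baseSet_at := hB
      coordChange := fun c d x v => (Φ d x).symm (Φ c x v)
      coordChange_self := fun c x _ v => (Φ c x).symm_apply_apply v
      continuousOn_coordChange := by
        rintro c d ⟨x, v⟩ ⟨hx, -⟩
        refine ContinuousAt.continuousWithinAt (tendsto_nhds_of_eventually_eq ?_)
        rw [nhds_prod_eq, nhds_discrete F, prod_pure, eventually_map]
        exact hΦ c d x hx v
      coordChange_comp := fun c d e x _ v => by simp }
  obtain ⟨σ, ⟨hσ₀, hσ⟩, -⟩ := (FiberBundle.isCoveringMap (F := F) (E := Z.Fiber)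
    ).existsUnique_continuousMap_lifts (ContinuousMap.id X) x₀
      (⟨x₀, (Φ x₀ x₀).symm v₀⟩ : Z.TotalSpace) rfl
  have hproj : ∀ x, (σ x).proj = x := fun x => congrFun hσ x
  refine ⟨fun x => Φ (σ x).proj (σ x).proj (σ x).2, ?_, fun c => ?_⟩
  · change Φ (σ x₀).proj (σ x₀).proj (σ x₀).2 = v₀
    rw [hσ₀]
    exact (Φ x₀ x₀).apply_symm_apply v₀
  · have hcont : ContinuousAt (fun x => (Z.localTriv c (σ x)).2) c := by
      refine continuousAt_snd.comp (ContinuousAt.comp (g := Z.localTriv c) ?_ σ.continuous.continuousAt)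
      refine (Z.localTriv c).continuousAt (x := σ c) ?_
      rw [Z.mem_localTriv_source, hproj]
      exact hB c
    refine ⟨(Z.localTriv c (σ c)).2, ?_⟩
    have hev : ∀ᶠ x in 𝓝 c, (Z.localTriv c (σ x)).2 = (Z.localTriv c (σ c)).2 :=
      hcont.eventually (p := fun v => v = (Z.localTriv c (σ c)).2) (by
        rw [nhds_discrete]; exact rfl)
    filter_upwards [hev] with x hx
    rw [← hx]
    have h1 : (Z.localTriv c (σ x)).2 =
      (Φ c (σ x).proj).symm (Φ (σ x).proj (σ x).proj (σ x).2) := rfl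
    rw [h1, hproj x, Equiv.apply_symm_apply]

section ParallelTransport

set_option maxSynthPendingDepth 3

variable {E F : Type*} [NormedAddCommGroup E] [NormedSpace ℝ E]
  [NormedAddCommGroup F] [NormedSpace ℝ F]

lemma IsParallelOn.congr_of_eventuallyEq {Ω : E → E →L[ℝ] F →L[ℝ] F} {q q' : E → F} {z : E}
    (hq : IsParallelOn Ω q {z}) (h : q' =ᶠ[𝓝 z] q) : IsParallelOn Ω q' {z} := by
  rintro _ rfl
  rw [h.eq_of_nhds]
  exact (hq _ rfl).congr_of_eventuallyEq h

/-- **Global Frobenius theorem**: on a simply connected open set, the equation `dq = Ω q` with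
flat `Ω` is solvable with arbitrary initial value at an arbitrary point. -/
theorem exists_isParallelOn_of_simplyConnected [CompleteSpace F] {Ω : E → E →L[ℝ] F →L[ℝ] F}
    {U : Set E} (hU : IsOpen U) [SimplyConnectedSpace U] (hΩ : ContDiffOn ℝ 2 Ω U)
    (hflat : ∀ z ∈ U, IsFlatAt Ω z) {x₀ : E} (hx₀ : x₀ ∈ U) (v₀ : F) :
    ∃ q : E → F, IsParallelOn Ω q U ∧ q x₀ = v₀ := by
  classical
  have := hU.locallyPathConnectedSpace
  choose S hSU hSo hSc hcS hS using
    fun c : U => exists_convex_forall_isParallelOn hU hΩ hflat c.2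
  choose sol hsol hsolc using fun (c : U) (v : F) => hS c c (hcS c) v
  have hcont : ∀ c, ContinuousOn Ω (S c) := fun c => hΩ.continuousOn.mono (hSU c)
  have hbij : ∀ (c : U) (z : E), z ∈ S c → Function.Bijective fun v => sol c v z := by
    refine fun c z hz => ⟨fun v w hvw => ?_, fun v => ?_⟩
    · have := (hsol c v).eqOn_of_convex (hSc c) (hcont c) (hsol c w) hz hvw (hcS c)
      rwa [hsolc, hsolc] at this
    · obtain ⟨q, hq, hqz⟩ := hS c z hz v
      exact ⟨q c, ((hsol c (q c)).eqOn_of_convex (hSc c) (hcont c) hq (hcS c)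
        (hsolc c (q c)) hz).trans hqz⟩
  let Φ : U → U → Equiv.Perm F := fun c z =>
    if h : (z : E) ∈ S c then Equiv.ofBijective _ (hbij c z h) else Equiv.refl F
  have hΦ : ∀ (c z : U) (v : F), (z : E) ∈ S c → Φ c z v = sol c v z := fun c z v h => by
    simp [Φ, h]
  have htrans : ∀ c d : U, ∀ x ∈ ((↑) : U → E) ⁻¹' S c ∩ ((↑) : U → E) ⁻¹' S d, ∀ v, ∀ᶠ y in 𝓝 x,
      (Φ d y).symm (Φ c y v) = (Φ d x).symm (Φ c x v) := fun c d x hx v => by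
    have hopen : (((↑) : U → E) ⁻¹' (S c ∩ S d)) ∈ 𝓝 x :=
      (((hSo c).inter (hSo d)).preimage continuous_subtype_val).mem_nhds hx
    filter_upwards [hopen] with y hy
    rw [Equiv.symm_apply_eq, hΦ c y v hy.1, hΦ d y _ hy.2]
    refine IsParallelOn.eqOn_of_convex ((hSc c).inter (hSc d))
      ((hcont c).mono inter_subset_left) ((hsol c v).mono inter_subset_left)
      ((hsol d _).mono inter_subset_right) hx ?_ hy
    rw [← hΦ c x v hx.1, ← hΦ d x _ hx.2, Equiv.apply_symm_apply]
  obtain ⟨q, hq₀, hq⟩ := exists_global_section_of_locally_constant_transition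
    (fun c : U => ((↑) : U → E) ⁻¹' S c) (fun c => (hSo c).preimage continuous_subtype_val) hcS Φ
    htrans ⟨x₀, hx₀⟩ v₀
  have hext : ∀ z : U, (fun y : E => if h : y ∈ U then q ⟨y, h⟩ else 0) z = q z := fun z => by
    simp
  refine ⟨fun y => if h : y ∈ U then q ⟨y, h⟩ else 0, fun z hz => ?_,
    (hext ⟨x₀, hx₀⟩).trans hq₀⟩
  obtain ⟨v, hv⟩ := hq ⟨z, hz⟩
  refine IsParallelOn.congr_of_eventuallyEq (q := sol ⟨z, hz⟩ v)
    ((hsol ⟨z, hz⟩ v).mono (singleton_subset_iff.2 (hcS ⟨z, hz⟩))) ?_ z rfl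
  have hv' : ∀ᶠ y : E in 𝓝 z, ∀ h : y ∈ U, q ⟨y, h⟩ = Φ ⟨z, hz⟩ ⟨y, h⟩ v := by
    rw [nhds_subtype_eq_comap, eventually_comap] at hv
    filter_upwards [hv] with y hy h using hy ⟨y, h⟩ rfl
  filter_upwards [hv', (hSo ⟨z, hz⟩).mem_nhds (hcS ⟨z, hz⟩)] with y hy hyS
  have hyU := hSU _ hyS
  rw [dif_pos hyU, hy hyU, hΦ _ _ _ hyS]

/-- On a preconnected open set, solutions are determined by their value at one point. -/
theorem IsParallelOn.eqOn_of_isPreconnected {Ω : E → E →L[ℝ] F →L[ℝ] F} {U : Set E}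
    (hU : IsOpen U) (hUc : IsPreconnected U) (hΩ : ContinuousOn Ω U) {q₁ q₂ : E → F}
    (h₁ : IsParallelOn Ω q₁ U) (h₂ : IsParallelOn Ω q₂ U) {x : E} (hx : x ∈ U)
    (hxe : q₁ x = q₂ x) : EqOn q₁ q₂ U := by
  intro y hy
  refine hUc.induction₂' (fun a b => q₁ a = q₂ a → q₁ b = q₂ b) (fun a ha => ?_)
    (fun a b c _ _ _ hab hbc h => hbc (hab h)) hx hy hxe
  obtain ⟨r, hr, hball⟩ := Metric.isOpen_iff.1 hU a ha
  have hloc : ∀ b ∈ ball a r, ∀ c ∈ ball a r, q₁ b = q₂ b → q₁ c = q₂ c := fun b hb c hc h =>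
    (h₁.mono hball).eqOn_of_convex (convex_ball a r) (hΩ.mono hball) (h₂.mono hball) hb h hc
  filter_upwards [mem_nhdsWithin_of_mem_nhds (ball_mem_nhds a hr)] with b hb
  exact ⟨hloc a (mem_ball_self hr) b hb, hloc b hb a (mem_ball_self hr)⟩

/-- Solutions of `dq = Ω q` with continuous `Ω` are continuously differentiable. -/
lemma IsParallelOn.contDiffOn {Ω : E → E →L[ℝ] F →L[ℝ] F} {U : Set E} (hU : IsOpen U)
    (hΩ : ContinuousOn Ω U) {q : E → F} (hq : IsParallelOn Ω q U) : ContDiffOn ℝ 1 q U := by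
  have hqc : ContinuousOn q U := fun z hz => (hq z hz).continuousAt.continuousWithinAt
  have hflip : ContinuousOn (fun z => (Ω z).flip) U :=
    (ContinuousLinearMap.flipₗᵢ ℝ E F F).continuous.comp_continuousOn hΩ
  rw [show (1 : WithTop ℕ∞) = 0 + 1 by norm_num, contDiffOn_succ_iff_fderiv_of_isOpen hU]
  refine ⟨fun z hz => (hq z hz).differentiableAt.differentiableWithinAt, by simp, ?_⟩
  rw [contDiffOn_zero]
  exact (hflip.clm_apply hqc).congr fun z hz => (hq z hz).fderiv

end ParallelTransport

section Pfaffian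

set_option maxSynthPendingDepth 3

variable {m s : ℕ}

/-- The continuous linear map of a real square matrix. -/
noncomputable def matrixCLM : Matrix (Fin s) (Fin s) ℝ →ₗ[ℝ] (Fin s → ℝ) →L[ℝ] (Fin s → ℝ) :=
  LinearMap.toContinuousLinearMap.toLinearMap ∘ₗ (Matrix.toLin').toLinearMap

@[simp]
lemma matrixCLM_apply (M : Matrix (Fin s) (Fin s) ℝ) (v : Fin s → ℝ) :
    matrixCLM M v = M *ᵥ v := rfl

lemma matrixCLM_mul (M N : Matrix (Fin s) (Fin s) ℝ) :
    matrixCLM (M * N) = (matrixCLM M).comp (matrixCLM N) := by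
  ext1 v
  simp [Matrix.mulVec_mulVec]

lemma matrixCLM_eq_sum (M : Matrix (Fin s) (Fin s) ℝ) :
    matrixCLM M = ∑ k, ∑ l, M k l • matrixCLM (Matrix.single k l (1 : ℝ)) := by
  conv_lhs => rw [Matrix.matrix_eq_sum_single M]
  simp only [map_sum, ← map_smul, Matrix.smul_single, smul_eq_mul, mul_one]

/-- The operator-valued one-form `∑ i, A i dx_i` of a Pfaffian system. -/
noncomputable def pfaffianForm (A : Fin m → (Fin m → ℝ) → Matrix (Fin s) (Fin s) ℝ)
    (z : Fin m → ℝ) : (Fin m → ℝ) →L[ℝ] (Fin s → ℝ) →L[ℝ] (Fin s → ℝ) :=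
  ∑ i, (ContinuousLinearMap.proj (R := ℝ) (φ := fun _ : Fin m => ℝ) i).smulRight
    (matrixCLM (A i z))

lemma pfaffianForm_apply (A : Fin m → (Fin m → ℝ) → Matrix (Fin s) (Fin s) ℝ)
    (z h : Fin m → ℝ) : pfaffianForm A z h = ∑ i, h i • matrixCLM (A i z) := by
  simp [pfaffianForm]

lemma pfaffianForm_single (A : Fin m → (Fin m → ℝ) → Matrix (Fin s) (Fin s) ℝ)
    (z : Fin m → ℝ) (i : Fin m) :
    pfaffianForm A z (Pi.single i 1) = matrixCLM (A i z) := by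
  rw [pfaffianForm_apply, Finset.sum_eq_single i] <;> simp +contextual

lemma contDiffOn_pfaffianForm {n : WithTop ℕ∞} {U : Set (Fin m → ℝ)}
    {A : Fin m → (Fin m → ℝ) → Matrix (Fin s) (Fin s) ℝ}
    (hA : ∀ i k l, ContDiffOn ℝ n (fun z => A i z k l) U) :
    ContDiffOn ℝ n (pfaffianForm A) U := by
  unfold pfaffianForm
  refine ContDiffOn.sum fun i _ => ?_
  have h : ContDiffOn ℝ n (fun z => matrixCLM (A i z)) U := by
    simp only [fun z => matrixCLM_eq_sum (A i z)]
    exact ContDiffOn.sum fun k _ => ContDiffOn.sum fun l _ => (hA i k l).smul contDiffOn_const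
  exact (ContinuousLinearMap.smulRightL ℝ _ _
    (ContinuousLinearMap.proj (R := ℝ) (φ := fun _ : Fin m => ℝ) i)).contDiff.comp_contDiffOn h

lemma fderiv_matrixCLM_apply {M : (Fin m → ℝ) → Matrix (Fin s) (Fin s) ℝ} {z : Fin m → ℝ}
    (hM : ∀ k l, DifferentiableAt ℝ (fun y => M y k l) z) (h : Fin m → ℝ) :
    DifferentiableAt ℝ (fun y => matrixCLM (M y)) z ∧
    fderiv ℝ (fun y => matrixCLM (M y)) z h = ∑ j, h j • matrixCLM (pdM j M z) := by
  have hder : HasFDerivAt (fun y => matrixCLM (M y))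
      (∑ k, ∑ l, (fderiv ℝ (fun y => M y k l) z).smulRight
        (matrixCLM (Matrix.single k l (1 : ℝ)))) z := by
    simp only [fun y => matrixCLM_eq_sum (M y)]
    exact HasFDerivAt.fun_sum fun k _ => HasFDerivAt.fun_sum fun l _ =>
      (hM k l).hasFDerivAt.smul_const _
  refine ⟨hder.differentiableAt, ?_⟩
  have hexp : ∀ k l, fderiv ℝ (fun y => M y k l) z h = (∑ j, h j • pdM j M z) k l := fun k l => by
    conv_lhs => rw [pi_eq_sum_univ' h]
    simp [pdM, Matrix.sum_apply]
  rw [hder.fderiv]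
  simp only [← map_smul, ← map_sum]
  rw [matrixCLM_eq_sum]
  simp [_root_.sum_apply, hexp]

lemma fderiv_pfaffianForm_apply {A : Fin m → (Fin m → ℝ) → Matrix (Fin s) (Fin s) ℝ}
    {z : Fin m → ℝ} (hA : ∀ i k l, DifferentiableAt ℝ (fun y => A i y k l) z)
    (h w : Fin m → ℝ) :
    fderiv ℝ (pfaffianForm A) z h w = ∑ i, ∑ j, (w i * h j) • matrixCLM (pdM j (A i) z) := by
  have hder : HasFDerivAt (fun y => pfaffianForm A y w)
      (∑ i, w i • fderiv ℝ (fun y => matrixCLM (A i y)) z) z := by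
    simp only [pfaffianForm_apply]
    exact HasFDerivAt.fun_sum fun i _ =>
      (fderiv_matrixCLM_apply (hA i) 0).1.hasFDerivAt.const_smul (w i)
  have hdiff : DifferentiableAt ℝ (pfaffianForm A) z := by
    unfold pfaffianForm
    refine DifferentiableAt.fun_sum fun i _ => ?_
    exact (ContinuousLinearMap.smulRightL ℝ _ _
      (ContinuousLinearMap.proj (R := ℝ) (φ := fun _ : Fin m => ℝ) i)).differentiableAt.comp z
      (fderiv_matrixCLM_apply (hA i) 0).1
  have huniq := hder.unique (hdiff.hasFDerivAt.clm_apply (hasFDerivAt_const w z))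
  have := congrArg (fun L => L h) huniq
  simp only [_root_.sum_apply, _root_.smul_apply,
    fun i => (fderiv_matrixCLM_apply (hA i) h).2, Finset.smul_sum, smul_smul] at this
  simpa using this.symm

lemma isFlatAt_pfaffianForm {A : Fin m → (Fin m → ℝ) → Matrix (Fin s) (Fin s) ℝ}
    {z : Fin m → ℝ} (hA : ∀ i k l, DifferentiableAt ℝ (fun y => A i y k l) z)
    (hint : ∀ i j : Fin m, i < j →
      pdM j (A i) z + A i z * A j z = pdM i (A j) z + A j z * A i z) :
    IsFlatAt (pfaffianForm A) z := by
  have hint' : ∀ i j : Fin m,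
      pdM j (A i) z + A i z * A j z = pdM i (A j) z + A j z * A i z := fun i j => by
    rcases lt_trichotomy i j with h | rfl | h
    exacts [hint i j h, rfl, (hint j i h).symm]
  have hexp : ∀ h w : Fin m → ℝ, fderiv ℝ (pfaffianForm A) z h w +
      (pfaffianForm A z w).comp (pfaffianForm A z h) =
      ∑ i, ∑ j, (w i * h j) • matrixCLM (pdM j (A i) z + A i z * A j z) := fun h w => by
    have hcomp : (pfaffianForm A z w).comp (pfaffianForm A z h) =
        ∑ i, ∑ j, (w i * h j) • matrixCLM (A i z * A j z) := by
      rw [Finset.sum_comm]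
      simp only [pfaffianForm_apply, ContinuousLinearMap.finsetSum_comp,
        ContinuousLinearMap.comp_finsetSum, matrixCLM_mul, ContinuousLinearMap.smul_comp,
        ContinuousLinearMap.comp_smul, smul_smul, Finset.smul_sum, mul_comm]
    rw [fderiv_pfaffianForm_apply hA, hcomp]
    simp only [map_add, smul_add, Finset.sum_add_distrib]
  intro h w
  rw [hexp, hexp, Finset.sum_comm]
  refine Finset.sum_congr rfl fun j _ => Finset.sum_congr rfl fun i _ => ?_
  rw [hint' i j, mul_comm]

lemma isParallelOn_pfaffianForm_iff {A : Fin m → (Fin m → ℝ) → Matrix (Fin s) (Fin s) ℝ}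
    {U : Set (Fin m → ℝ)} {q : (Fin m → ℝ) → Fin s → ℝ}
    (hq : ∀ z ∈ U, DifferentiableAt ℝ q z) :
    IsParallelOn (pfaffianForm A) q U ↔
      ∀ z ∈ U, ∀ i, fderiv ℝ q z (Pi.single i 1) = A i z *ᵥ q z := by
  refine forall₂_congr fun z hz => ⟨fun h i => ?_, fun h => ?_⟩
  · rw [h.fderiv, ContinuousLinearMap.flip_apply, pfaffianForm_single, matrixCLM_apply]
  · refine (hq z hz).hasFDerivAt.congr_fderiv ?_
    refine ContinuousLinearMap.coe_injective (LinearMap.pi_ext' fun i => LinearMap.ext_ring ?_)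
    simpa [pfaffianForm_single] using h i

end Pfaffian

end Frobenius

/-- Frobenius existence and uniqueness: on an open simply connected set, a Pfaffian
system with smooth coefficient matrices satisfying the integrability condition has,
for any point `zbar` and any value `qbar`, a unique continuously differentiable solution
with `q(zbar) = qbar` (uniqueness meaning any two such solutions agree on `U`). -/
theorem stmt10 {m s : ℕ}
    (U : Set (Fin m → ℝ)) (hU : IsOpen U) (hUsc : SimplyConnectedSpace U)
    (A : Fin m → (Fin m → ℝ) → Matrix (Fin s) (Fin s) ℝ)
    (hA : ∀ i k l, ContDiffOn ℝ (⊤ : ℕ∞) (fun z => A i z k l) U)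
    (hint : ∀ i j : Fin m, i < j → ∀ z ∈ U,
      pdM j (A i) z + A i z * A j z = pdM i (A j) z + A j z * A i z) :
    ∀ zbar ∈ U, ∀ qbar : Fin s → ℝ,
      ∃ q : (Fin m → ℝ) → (Fin s → ℝ),
        (ContDiffOn ℝ 1 q U ∧
          (∀ z ∈ U, ∀ i, fderiv ℝ q z (Pi.single i 1) = A i z *ᵥ q z) ∧
          q zbar = qbar) ∧
        ∀ q' : (Fin m → ℝ) → (Fin s → ℝ),
          (ContDiffOn ℝ 1 q' U ∧
            (∀ z ∈ U, ∀ i, fderiv ℝ q' z (Pi.single i 1) = A i z *ᵥ q' z) ∧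
            q' zbar = qbar) →
          Set.EqOn q' q U := by
  intro zbar hz qbar
  have hΩ : ContDiffOn ℝ 2 (pfaffianForm A) U :=
    contDiffOn_pfaffianForm fun i k l => (hA i k l).of_le
      (WithTop.coe_le_coe.2 (le_top : (2 : ℕ∞) ≤ ⊤))
  have hd : ∀ z ∈ U, ∀ i k l, DifferentiableAt ℝ (fun y => A i y k l) z := fun z hz i k l =>
    ((hA i k l).contDiffAt (hU.mem_nhds hz)).differentiableAt (by simp)
  obtain ⟨q, hq, hqz⟩ := exists_isParallelOn_of_simplyConnected hU hΩ
    (fun z hz => isFlatAt_pfaffianForm (hd z hz) fun i j hij => hint i j hij z hz) hz qbar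
  refine ⟨q, ⟨hq.contDiffOn hU hΩ.continuousOn,
    (isParallelOn_pfaffianForm_iff fun z hz => (hq z hz).differentiableAt).1 hq, hqz⟩, ?_⟩
  rintro q' ⟨hq'1, hq', hq'z⟩
  have hUc : IsPreconnected U := isPreconnected_iff_preconnectedSpace.2 inferInstance
  refine IsParallelOn.eqOn_of_isPreconnected hU hUc hΩ.continuousOn
    ((isParallelOn_pfaffianForm_iff fun z hz => ?_).2 hq') hq hz (hq'z.trans hqz.symm)
  exact (hq'1.contDiffAt (hU.mem_nhds hz)).differentiableAt one_ne_zero
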